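/- arXiv:quant-ph/0608024 — 9 statements merged into one kernel-verified Lean document; each statement's English description precedes it below -/
import Mathlib

section
/- Let ψ_1, …, ψ_n be nonzero vectors in ℂ^d with n ≤ d and let S = Σ_{k=1}^n |ψ_k⟩⟨ψ_k| satisfy Tr(S) = 1. Then Tr(S²) = 1/n if and only if the vectors are pairwise orthogonal and all have the same norm, namely ‖ψ_k‖² = 1/n for every k. -/
open Matrix BigOperators

open scoped ComplexOrder in
/-- A Hermitian matrix of trace one satisfies `Tr(G²) = 1/n` exactly when it is the normalized
identity. -/
theorem Matrix.IsHermitian.trace_mul_self_eq_inv_card_iff {n : ℕ} {G : Matrix (Fin n) (Fin n) ℂ}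
    (hG : G.IsHermitian) (htr : G.trace = 1) :
    (G * G).trace = 1 / n ↔ G = (1 / n : ℂ) • 1 := by
  have hn : (n : ℂ) ≠ 0 := by
    intro h
    obtain rfl : n = 0 := by exact_mod_cast h
    simp [Matrix.trace] at htr
  have hH : (G - (1 / n : ℂ) • 1)ᴴ = G - (1 / n : ℂ) • 1 := by
    simp [conjTranspose_sub, conjTranspose_smul, hG.eq]
  have key : ((G - (1 / n : ℂ) • 1)ᴴ * (G - (1 / n : ℂ) • 1)).trace
      = (G * G).trace - 1 / n := by
    rw [hH]
    simp only [sub_mul, mul_sub, smul_mul_assoc, mul_smul_comm, one_mul, mul_one, trace_sub,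
      trace_smul, htr, trace_one, Fintype.card_fin, smul_eq_mul]
    field_simp
    ring
  rw [← sub_eq_zero, ← key, trace_conjTranspose_mul_self_eq_zero_iff, sub_eq_zero]

/-- For `n ≤ d` nonzero vectors in `ℂ^d` whose frame operator
`S = ∑ k, |ψ k⟩⟨ψ k|` has unit trace: `Tr(S²) = 1/n` iff the vectors are
pairwise orthogonal and all have squared norm `1/n`. -/
theorem trace_sq_eq_inv_card_iff_orthogonal {d n : ℕ} (hnd : n ≤ d)
    (ψ : Fin n → Fin d → ℂ) (hψ : ∀ k, ψ k ≠ 0)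
    (S : Matrix (Fin d) (Fin d) ℂ)
    (hS : S = ∑ k, vecMulVec (ψ k) (star (ψ k)))
    (htr : S.trace = 1) :
    (S * S).trace = 1 / n ↔
      ((∀ j k, j ≠ k → star (ψ j) ⬝ᵥ ψ k = 0) ∧
        ∀ k, star (ψ k) ⬝ᵥ ψ k = 1 / n) := by
  set B : Matrix (Fin d) (Fin n) ℂ := Matrix.of fun i k => ψ k i with hB
  have hSB : S = B * Bᴴ := by
    ext i j
    simp [hS, hB, Matrix.sum_apply, Matrix.mul_apply, vecMulVec_apply]
  have hG : ∀ j k, (Bᴴ * B) j k = star (ψ j) ⬝ᵥ ψ k := by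
    intro j k
    simp [hB, Matrix.mul_apply, dotProduct]
  have htrG : (Bᴴ * B).trace = 1 := by
    rw [trace_mul_comm, ← hSB, htr]
  have hSS : (S * S).trace = ((Bᴴ * B) * (Bᴴ * B)).trace := by
    rw [hSB, Matrix.mul_assoc, trace_mul_comm]
    simp only [Matrix.mul_assoc]
  rw [hSS, (isHermitian_conjTranspose_mul_self B).trace_mul_self_eq_inv_card_iff htrG]
  simp only [← hG]
  constructor
  · intro h
    rw [h]
    exact ⟨fun j k hjk => by simp [hjk], fun k => by simp⟩
  · rintro ⟨hoff, hdiag⟩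
    ext j k
    by_cases hjk : j = k
    · subst hjk
      simp [hdiag]
    · simp [hoff j k hjk, hjk]
end

section
/- Let ψ_1, …, ψ_n be unit vectors in ℂ^d and p_1, …, p_n nonnegative reals with Σ_k p_k = 1. Then for every positive integer t, Σ_{j=1}^n Σ_{k=1}^n p_j p_k |⟨ψ_j, ψ_k⟩|^{2t} ≥ t!·(d−1)!/(t+d−1)!. -/
open Matrix BigOperators

section WeightedFamily

variable {κ ι : Type*} [Fintype κ] [Fintype ι]

/-- The purity of the weighted sum of rank-one operators, written as its squared Frobenius norm. -/
theorem sum_mul_norm_dotProduct_sq_eq (v : κ → ι → ℂ) (p : κ → ℝ) :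
    ∑ j, ∑ k, p j * p k * ‖star (v j) ⬝ᵥ v k‖ ^ 2 =
      ∑ a, ∑ b, ‖∑ k, (p k : ℂ) * (v k a * star (v k b))‖ ^ 2 := by
  apply Complex.ofReal_injective
  push_cast
  simp only [← Complex.mul_conj', dotProduct, map_sum, map_mul, Pi.star_apply,
    Complex.star_def, Complex.conj_conj, Complex.conj_ofReal, Finset.sum_mul_sum]
  simp only [Finset.mul_sum]
  calc _ = ∑ j, ∑ a, ∑ k, ∑ b, (p j : ℂ) * p k *
        ((starRingEnd ℂ) (v j a) * v k a * (v j b * (starRingEnd ℂ) (v k b))) :=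
        Finset.sum_congr rfl fun j _ ↦ Finset.sum_comm
    _ = ∑ a, ∑ j, ∑ b, ∑ k, (p j : ℂ) * p k *
        ((starRingEnd ℂ) (v j a) * v k a * (v j b * (starRingEnd ℂ) (v k b))) := by
        rw [Finset.sum_comm]
        exact Finset.sum_congr rfl fun a _ ↦ Finset.sum_congr rfl fun j _ ↦ Finset.sum_comm
    _ = _ := by
        refine Finset.sum_congr rfl fun a _ ↦ ?_
        rw [Finset.sum_comm]
        refine Finset.sum_congr rfl fun b _ ↦ ?_
        rw [Finset.sum_comm]
        refine Finset.sum_congr rfl fun j _ ↦ Finset.sum_congr rfl fun k _ ↦ ?_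
        ring

/-- A weighted family of unit vectors in a space of dimension `N` has purity at least `1 / N`. -/
theorem inv_card_le_sum_mul_norm_dotProduct_sq (v : κ → ι → ℂ)
    (hv : ∀ k, star (v k) ⬝ᵥ v k = 1) (p : κ → ℝ) (hp : ∑ k, p k = 1) :
    (Fintype.card ι : ℝ)⁻¹ ≤ ∑ j, ∑ k, p j * p k * ‖star (v j) ⬝ᵥ v k‖ ^ 2 := by
  set M : ι → ι → ℂ := fun a b ↦ ∑ k, (p k : ℂ) * (v k a * star (v k b))
  have trace_eq : ∑ a, M a a = 1 := by
    simp only [M]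
    rw [Finset.sum_comm]
    simp only [← Finset.mul_sum]
    have (k : κ) : ∑ a, v k a * star (v k a) = 1 := by
      rw [← hv k]
      exact Finset.sum_congr rfl fun a _ ↦ mul_comm _ _
    simp only [this, mul_one]
    exact_mod_cast hp
  have one_le : 1 ≤ ∑ a, ‖M a a‖ := by
    simpa [trace_eq] using norm_sum_le Finset.univ fun a ↦ M a a
  have cauchy : (∑ a, ‖M a a‖) ^ 2 ≤ Fintype.card ι * ∑ a, ‖M a a‖ ^ 2 :=
    sq_sum_le_card_mul_sum_sq
  have diag_le : ∑ a, ‖M a a‖ ^ 2 ≤ ∑ a, ∑ b, ‖M a b‖ ^ 2 :=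
    Finset.sum_le_sum fun a _ ↦
      Finset.single_le_sum (f := fun b ↦ ‖M a b‖ ^ 2) (fun b _ ↦ sq_nonneg _) (Finset.mem_univ a)
  have card_pos : (0 : ℝ) < Fintype.card ι := by
    have : Nonempty ι := by
      by_contra h
      rw [not_nonempty_iff] at h
      simp at trace_eq
    exact_mod_cast Fintype.card_pos
  rw [sum_mul_norm_dotProduct_sq_eq, inv_le_iff_one_le_mul₀' card_pos]
  calc (1 : ℝ) ≤ (∑ a, ‖M a a‖) ^ 2 := one_le_pow₀ one_le
    _ ≤ _ := cauchy.trans (by gcongr)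

end WeightedFamily

/-- The coordinates of `x ^ ⊗t` in the orthonormal basis of the symmetric subspace given by
normalised monomials. -/
noncomputable def symPower {ι : Type*} [DecidableEq ι] (t : ℕ) (x : ι → ℂ) (s : Sym ι t) : ℂ :=
  (√(s.1.countPerms : ℝ) : ℝ) * (s.1.map x).prod

theorem star_symPower_dotProduct {ι : Type*} [DecidableEq ι] [Fintype ι] (t : ℕ) (x y : ι → ℂ) :
    star (symPower t x) ⬝ᵥ symPower t y = (star x ⬝ᵥ y) ^ t := by
  simp only [dotProduct]
  rw [Finset.sum_pow, Finset.sym_univ]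
  refine Finset.sum_congr rfl fun s _ ↦ ?_
  have sqrt_mul : ((√(s.1.countPerms : ℝ) : ℝ) : ℂ) * (√(s.1.countPerms : ℝ) : ℝ) =
      s.1.countPerms := by
    rw [← Complex.ofReal_mul, Real.mul_self_sqrt (Nat.cast_nonneg _), Complex.ofReal_natCast]
  have star_prod : star (s.1.map x).prod = (s.1.map fun i ↦ star (x i)).prod := by
    simpa [Multiset.map_map, Function.comp_def] using
      map_multiset_prod (starRingEnd ℂ) (s.1.map x)
  simp only [Pi.star_apply, symPower, star_mul', star_prod, Multiset.prod_map_mul,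
    Complex.star_def, Complex.conj_ofReal, ← sqrt_mul]
  ring

/-- For an ensemble of unit vectors `ψ k` in `ℂ^d` with
probability weights `p k`, and every positive integer `t`,
`∑ j k, p j * p k * |⟨ψ j, ψ k⟩|^(2t) ≥ t!(d-1)!/(t+d-1)!`.
(The left-hand side is `Tr(S_t²)` for the `t`-extended density operator.) -/
theorem purity_t_extended_ge {d n : ℕ}
    (ψ : Fin n → Fin d → ℂ) (hψ : ∀ k, star (ψ k) ⬝ᵥ ψ k = 1)
    (p : Fin n → ℝ) (hp : ∀ k, 0 ≤ p k) (hp1 : ∑ k, p k = 1)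
    (t : ℕ) (ht : 1 ≤ t) :
    ((t.factorial : ℝ) * (d - 1).factorial) / (t + d - 1).factorial ≤
      ∑ j, ∑ k, p j * p k * ‖star (ψ j) ⬝ᵥ ψ k‖ ^ (2 * t) := by
  have hd : 1 ≤ d := by
    by_contra! h
    obtain rfl : d = 0 := by omega
    obtain rfl | hn := n.eq_zero_or_pos
    · simp at hp1
    · simpa using hψ ⟨0, hn⟩
  have purity := inv_card_le_sum_mul_norm_dotProduct_sq (fun k ↦ symPower t (ψ k))
    (fun k ↦ by rw [star_symPower_dotProduct, hψ, one_pow]) p hp1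
  simp only [star_symPower_dotProduct, norm_pow, ← pow_mul, mul_comm t 2] at purity
  refine le_of_eq_of_le ?_ purity
  rw [Sym.card_sym_eq_choose, Fintype.card_fin, Nat.cast_choose ℝ (by omega : t ≤ d + t - 1),
    inv_div, show d + t - 1 - t = d - 1 by omega, add_comm d t]
end

section
/- Let ψ_1, …, ψ_n be unit vectors in ℂ^d and p_1, …, p_n nonnegative reals with Σ_k p_k = 1, and write Π_k = |ψ_k⟩⟨ψ_k|. Then Σ_{j,k} p_j p_k |⟨ψ_j, ψ_k⟩|⁴ ≥ 2/(d(d+1)), with equality if and only if Σ_k p_k (Π_k ⊗ Π_k) = (1/(d(d+1)))·(I + SWAP), where SWAP is the swap operator on ℂ^d ⊗ ℂ^d; that is, equality holds if and only if the ensemble is a generalized 2-design. -/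
open Matrix Kronecker BigOperators

/-- The rank-one projector `|ψ⟩⟨ψ|` onto a vector `ψ ∈ ℂ^d`. -/
noncomputable def proj {d : ℕ} (ψ : Fin d → ℂ) : Matrix (Fin d) (Fin d) ℂ :=
  vecMulVec ψ (star ψ)

/-- The swap operator on `ℂ^d ⊗ ℂ^d`, mapping `u ⊗ v` to `v ⊗ u`. -/
def swapMatrix (d : ℕ) : Matrix (Fin d × Fin d) (Fin d × Fin d) ℂ :=
  Matrix.of fun p q => if p.1 = q.2 ∧ p.2 = q.1 then 1 else 0

theorem swapMatrix_mul_self (d : ℕ) : swapMatrix d * swapMatrix d = 1 := by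
  ext ⟨a, b⟩ ⟨a', b'⟩
  simp only [swapMatrix, mul_apply, of_apply, one_apply, Fintype.sum_prod_type, Prod.mk.injEq,
    ite_and, mul_ite, mul_one, mul_zero]
  simp

theorem trace_swapMatrix (d : ℕ) : (swapMatrix d).trace = d := by
  simp [swapMatrix, trace, Fintype.sum_prod_type, ite_and]

theorem conjTranspose_swapMatrix (d : ℕ) : (swapMatrix d)ᴴ = swapMatrix d := by
  ext ⟨a, b⟩ ⟨a', b'⟩
  simp only [swapMatrix, conjTranspose_apply, of_apply, apply_ite star, star_one, star_zero]
  congr 1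
  grind

theorem trace_kronecker_mul_swapMatrix {d : ℕ} (A B : Matrix (Fin d) (Fin d) ℂ) :
    ((A ⊗ₖ B) * swapMatrix d).trace = (A * B).trace := by
  simp only [swapMatrix, trace, diag_apply, mul_apply, of_apply, kroneckerMap_apply,
    Fintype.sum_prod_type, ite_and, mul_ite, mul_one, mul_zero]
  simp

theorem conjTranspose_proj {d : ℕ} (ψ : Fin d → ℂ) : (proj ψ)ᴴ = proj ψ := by
  simp [proj, conjTranspose_vecMulVec]

theorem trace_proj {d : ℕ} (ψ : Fin d → ℂ) : (proj ψ).trace = star ψ ⬝ᵥ ψ := by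
  rw [proj, trace_vecMulVec, dotProduct_comm]

theorem trace_proj_mul_proj {d : ℕ} (φ ψ : Fin d → ℂ) :
    (proj φ * proj ψ).trace = (‖star φ ⬝ᵥ ψ‖ : ℂ) ^ 2 := by
  have h : star (star φ ⬝ᵥ ψ) = star ψ ⬝ᵥ φ := by rw [star_dotProduct, star_star]
  rw [proj, proj, vecMulVec_mul_vecMulVec, trace_vecMulVec, ← Complex.mul_conj',
    ← Complex.star_def, h, dotProduct_smul, dotProduct_comm φ, smul_eq_mul]

/-- The squared Hilbert–Schmidt distance of the second moment of an ensemble to the normalized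
symmetric projector is the excess of its frame potential over the Welch bound. -/
theorem trace_secondMoment_sub_sq {d n : ℕ} (hd : d ≠ 0)
    (ψ : Fin n → Fin d → ℂ) (hψ : ∀ k, star (ψ k) ⬝ᵥ ψ k = 1)
    (p : Fin n → ℝ) (hp1 : ∑ k, p k = 1)
    (D : Matrix (Fin d × Fin d) (Fin d × Fin d) ℂ)
    (hD : D = ∑ k, (p k : ℂ) • (proj (ψ k) ⊗ₖ proj (ψ k)) -
      (1 / ((d : ℂ) * (d + 1))) • (1 + swapMatrix d)) :
    (Dᴴ * D).trace = ((∑ j, ∑ k, p j * p k * ‖star (ψ j) ⬝ᵥ ψ k‖ ^ 4 -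
      2 / ((d : ℝ) * (d + 1)) : ℝ) : ℂ) := by
  have hd0 : (d : ℂ) ≠ 0 := Nat.cast_ne_zero.mpr hd
  have hd1 : (d : ℂ) + 1 ≠ 0 := Nat.cast_add_one_ne_zero d
  have hp1' : ∑ k, (p k : ℂ) = 1 := by exact_mod_cast hp1
  set S := ∑ k, (p k : ℂ) • (proj (ψ k) ⊗ₖ proj (ψ k)) with hS
  set c : ℂ := 1 / ((d : ℂ) * (d + 1)) with hc
  have hDh : Dᴴ = D := by
    have hcs : star c = c := by simp [hc]
    have hSs : Sᴴ = S := by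
      simp [hS, conjTranspose_sum, conjTranspose_smul, conjTranspose_kronecker, conjTranspose_proj]
    rw [hD, conjTranspose_sub, hSs, conjTranspose_smul, hcs, conjTranspose_add,
      conjTranspose_one, conjTranspose_swapMatrix]
  have hS1 : S.trace = 1 := by
    simp [hS, trace_sum, trace_smul, trace_kronecker, trace_proj, hψ, hp1']
  have hSW : (S * swapMatrix d).trace = 1 := by
    simp [hS, Finset.sum_mul, trace_sum, trace_smul, trace_kronecker_mul_swapMatrix,
      trace_proj_mul_proj, hψ, hp1']
  have hSS : (S * S).trace =
      ((∑ j, ∑ k, p j * p k * ‖star (ψ j) ⬝ᵥ ψ k‖ ^ 4 : ℝ) : ℂ) := by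
    simp only [hS, Finset.sum_mul_sum, trace_sum, smul_mul_smul_comm, ← mul_kronecker_mul,
      trace_smul, trace_kronecker, trace_proj_mul_proj, smul_eq_mul]
    push_cast
    refine Finset.sum_congr rfl fun j _ => Finset.sum_congr rfl fun k _ => ?_
    ring
  have hexp : D * D = S * S - c • (S + S * swapMatrix d) - c • (S + swapMatrix d * S) +
      (c * c) • (1 + swapMatrix d + swapMatrix d + 1) := by
    rw [hD]
    simp only [sub_mul, mul_sub, smul_mul_assoc, mul_smul_comm, add_mul, mul_add, one_mul,
      mul_one, swapMatrix_mul_self, smul_add, smul_sub, mul_smul]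
    abel
  rw [hDh, hexp]
  simp only [trace_sub, trace_add, trace_smul, hSS, hS1, trace_mul_comm (swapMatrix d) S, hSW,
    trace_one, trace_swapMatrix, Fintype.card_prod, Fintype.card_fin, smul_eq_mul, hc]
  push_cast
  field_simp
  ring

/-- For an ensemble of unit vectors with weights `p`,
`∑ j k, p j * p k * |⟨ψ j, ψ k⟩|⁴ ≥ 2/(d(d+1))`, with equality iff the
ensemble is a generalized 2-design, i.e.
`∑ k, p k • (Π k ⊗ Π k) = (1/(d(d+1))) • (I + SWAP)`. -/
theorem purity_two_extended_ge_iff_design {d n : ℕ}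
    (ψ : Fin n → Fin d → ℂ) (hψ : ∀ k, star (ψ k) ⬝ᵥ ψ k = 1)
    (p : Fin n → ℝ) (hp : ∀ k, 0 ≤ p k) (hp1 : ∑ k, p k = 1) :
    (2 / ((d : ℝ) * (d + 1)) ≤ ∑ j, ∑ k, p j * p k * ‖star (ψ j) ⬝ᵥ ψ k‖ ^ 4) ∧
    ((∑ j, ∑ k, p j * p k * ‖star (ψ j) ⬝ᵥ ψ k‖ ^ 4 = 2 / ((d : ℝ) * (d + 1))) ↔
      ∑ k, (p k : ℂ) • (proj (ψ k) ⊗ₖ proj (ψ k)) =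
        (1 / ((d : ℂ) * (d + 1))) • (1 + swapMatrix d)) := by
  have hd : d ≠ 0 := by
    rintro rfl
    have hn : IsEmpty (Fin n) := ⟨fun k => by simpa using hψ k⟩
    simp at hp1
  have key := trace_secondMoment_sub_sq hd ψ hψ p hp1 _ rfl
  constructor
  · open scoped ComplexOrder in
    have h := (posSemidef_conjTranspose_mul_self
      (∑ k, (p k : ℂ) • (proj (ψ k) ⊗ₖ proj (ψ k)) -
        (1 / ((d : ℂ) * (d + 1))) • (1 + swapMatrix d))).trace_nonneg
    rw [key] at h
    exact sub_nonneg.mp (Complex.zero_le_real.mp h)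
  · open scoped ComplexOrder in
    rw [← sub_eq_zero, ← Complex.ofReal_eq_zero, ← key,
      trace_conjTranspose_mul_self_eq_zero_iff, sub_eq_zero]
end

section
/- Let ψ_1, …, ψ_n be unit vectors in ℂ^d with strictly positive probability weights p_k > 0 summing to 1 and Π_k = |ψ_k⟩⟨ψ_k|. If the ensemble is a generalized 2-design, i.e. Σ_k p_k (Π_k ⊗ Π_k) = (1/(d(d+1)))·(I + SWAP), then n ≥ d². -/
open Matrix Kronecker BigOperators

/-- Contracting the 2-design condition against `A` gives `∑ₖ wₖ Tr(A Pₖ) Pₖ = c (A + Tr(A) I)`. -/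
theorem sum_trace_smul_of_sum_kronecker_eq {d : ℕ} {ι : Type*} [Fintype ι]
    (P : ι → Matrix (Fin d) (Fin d) ℂ) (w : ι → ℂ) (c : ℂ)
    (h : ∑ k, w k • (P k ⊗ₖ P k) = c • (1 + swapMatrix d)) (A : Matrix (Fin d) (Fin d) ℂ) :
    ∑ k, (w k * (A * P k).trace) • P k = c • (A + A.trace • 1) := by
  ext i j
  have entry : ∀ a b, ∑ k, w k * (P k i j * P k a b) =
      c * ((if i = j ∧ a = b then 1 else 0) + if i = b ∧ a = j then 1 else 0) := fun a b => by
    simpa [Matrix.sum_apply, swapMatrix, Matrix.one_apply, Prod.ext_iff] using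
      congrFun (congrFun h (i, a)) (j, b)
  calc (∑ k, (w k * (A * P k).trace) • P k) i j
      = ∑ b, ∑ a, A b a * ∑ k, w k * (P k i j * P k a b) := by
        simp only [Matrix.sum_apply, Matrix.smul_apply, smul_eq_mul, Matrix.trace, Matrix.diag,
          Matrix.mul_apply, Finset.mul_sum, Finset.sum_mul]
        rw [Finset.sum_comm]
        refine Finset.sum_congr rfl fun b _ => ?_
        rw [Finset.sum_comm]
        exact Finset.sum_congr rfl fun a _ => Finset.sum_congr rfl fun k _ => by ring
    _ = (c • (A + A.trace • (1 : Matrix (Fin d) (Fin d) ℂ))) i j := by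
        simp only [entry, Matrix.smul_apply, Matrix.add_apply, smul_eq_mul, Matrix.trace,
          Matrix.diag, Matrix.one_apply, mul_add, Finset.sum_add_distrib, ite_and]
        by_cases hij : i = j <;> simp [hij, Finset.mul_sum, mul_comm, add_comm]

/-- The map `A ↦ A + Tr(A) I` is injective on complex matrices. -/
theorem eq_zero_of_add_trace_smul_one_eq_zero {d : ℕ} {A : Matrix (Fin d) (Fin d) ℂ}
    (h : A + A.trace • 1 = 0) : A = 0 := by
  have ht : A.trace * (1 + d) = 0 := by
    simpa [Matrix.trace_add, Matrix.trace_smul, mul_add] using congrArg Matrix.trace h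
  have hd : (1 + d : ℂ) ≠ 0 := by
    rw [add_comm]
    exact Nat.cast_add_one_ne_zero d
  simpa [(mul_eq_zero.mp ht).resolve_right hd] using h

/-- A generalized 2-design with strictly positive weights
requires at least `d²` states. -/
theorem gen_two_design_card_ge {d n : ℕ}
    (ψ : Fin n → Fin d → ℂ) (hψ : ∀ k, star (ψ k) ⬝ᵥ ψ k = 1)
    (p : Fin n → ℝ) (hp : ∀ k, 0 < p k) (hp1 : ∑ k, p k = 1)
    (hdesign : ∑ k, (p k : ℂ) • (proj (ψ k) ⊗ₖ proj (ψ k)) =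
      (1 / ((d : ℂ) * (d + 1))) • (1 + swapMatrix d)) :
    d ^ 2 ≤ n := by
  rcases Nat.eq_zero_or_pos d with rfl | hd
  · simp
  have hc : 1 / ((d : ℂ) * (d + 1)) ≠ 0 :=
    one_div_ne_zero <| mul_ne_zero (Nat.cast_ne_zero.mpr hd.ne') (Nat.cast_add_one_ne_zero d)
  let L : Matrix (Fin d) (Fin d) ℂ →ₗ[ℂ] (Fin n → ℂ) :=
    LinearMap.pi fun k => Matrix.traceLinearMap (Fin d) ℂ ℂ ∘ₗ LinearMap.mulRight ℂ (proj (ψ k))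
  have hL : Function.Injective L := by
    refine (injective_iff_map_eq_zero L).mpr fun A hA => ?_
    have htr : ∀ k, (A * proj (ψ k)).trace = 0 := fun k => congrFun hA k
    have hsum := sum_trace_smul_of_sum_kronecker_eq _ _ _ hdesign A
    simp only [htr, mul_zero, zero_smul, Finset.sum_const_zero] at hsum
    exact eq_zero_of_add_trace_smul_one_eq_zero ((smul_eq_zero.mp hsum.symm).resolve_left hc)
  simpa [Module.finrank_matrix, sq] using LinearMap.finrank_le_finrank_of_injective hL
end

section
/- (Lemma 1, bound on average fidelity for generalized 2-designs.) Let ψ_1, …, ψ_n be unit vectors in ℂ^d with probability weights p_i ≥ 0 summing to 1 and Π_i = |ψ_i⟩⟨ψ_i|, and suppose the ensemble is a generalized 2-design: Σ_i p_i (Π_i ⊗ Π_i) = (1/(d(d+1)))·(I + SWAP). Then for every finite POVM {E_b}_{b=1}^m (positive semidefinite operators with Σ_b E_b = I) and every family of density matrices {σ_b}_{b=1}^m (positive semidefinite with trace 1), the average fidelity satisfies Σ_{b=1}^m Σ_{i=1}^n p_i · Tr(Π_i E_b) · Tr(Π_i σ_b) ≤ 2/(d+1). -/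
open Matrix Kronecker BigOperators
open scoped ComplexOrder

open scoped Matrix.Norms.Frobenius in
/-- `Tr(Aᴴ A)` is the squared Frobenius norm of `A`. -/
lemma trace_conjTranspose_mul_self_eq_frobenius_norm_sq {m n : Type*} [Fintype m] [Fintype n]
    (A : Matrix m n ℂ) : (Aᴴ * A).trace = ((‖A‖ ^ 2 : ℝ) : ℂ) := by
  have h : ‖A‖ ^ 2 = ∑ i, ∑ j, ‖A i j‖ ^ 2 := by
    rw [frobenius_norm_def, ← Real.sqrt_eq_rpow, Real.sq_sqrt (by positivity)]
    simp
  rw [h, Finset.sum_comm]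
  simp [trace, mul_apply, Complex.conj_mul']

open scoped Matrix.Norms.Frobenius MatrixOrder in
/-- For positive semidefinite matrices, `Tr(A B) ≤ Tr(A) Tr(B)`. -/
lemma Matrix.PosSemidef.re_trace_mul_le {n : Type*} [Fintype n] [DecidableEq n]
    {A B : Matrix n n ℂ} (hA : A.PosSemidef) (hB : B.PosSemidef) :
    (A * B).trace.re ≤ A.trace.re * B.trace.re := by
  obtain ⟨X, rfl⟩ := CStarAlgebra.nonneg_iff_eq_star_mul_self.mp hA.nonneg
  obtain ⟨Y, rfl⟩ := CStarAlgebra.nonneg_iff_eq_star_mul_self.mp hB.nonneg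
  simp only [star_eq_conjTranspose]
  have h : (Xᴴ * X * (Yᴴ * Y)).trace = ((X * Yᴴ)ᴴ * (X * Yᴴ)).trace := by
    rw [conjTranspose_mul, conjTranspose_conjTranspose, ← Matrix.mul_assoc, trace_mul_comm]
    simp only [Matrix.mul_assoc]
  rw [h]
  simp only [trace_conjTranspose_mul_self_eq_frobenius_norm_sq, Complex.ofReal_re]
  rw [← mul_pow, ← frobenius_norm_conjTranspose Y]
  gcongr
  exact frobenius_norm_mul _ _

/-- The trace of a product of Hermitian matrices is real. -/
lemma Matrix.IsHermitian.im_trace_mul {n : Type*} [Fintype n]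
    {A B : Matrix n n ℂ} (hA : A.IsHermitian) (hB : B.IsHermitian) :
    (A * B).trace.im = 0 := by
  rw [← Complex.conj_eq_iff_im, starRingEnd_apply, ← trace_conjTranspose, conjTranspose_mul,
    hA.eq, hB.eq, trace_mul_comm]

lemma isHermitian_proj {d : ℕ} (ψ : Fin d → ℂ) : (proj ψ).IsHermitian := by
  ext i j
  simp [proj, vecMulVec_apply, mul_comm]

/-- The swap trick: `Tr(SWAP (A ⊗ B)) = Tr(A B)`. -/
lemma trace_swapMatrix_mul_kronecker {d : ℕ} (A B : Matrix (Fin d) (Fin d) ℂ) :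
    (swapMatrix d * (A ⊗ₖ B)).trace = (A * B).trace := by
  simp only [trace, diag, mul_apply, swapMatrix, of_apply, kroneckerMap_apply,
    Fintype.sum_prod_type, ite_and, ite_mul, one_mul, zero_mul]
  rw [Finset.sum_comm]
  simp

/-- Averaging a product of two expectation values over a generalized 2-design. -/
lemma sum_trace_proj_mul_of_gen_two_design {d n : ℕ} {ψ : Fin n → Fin d → ℂ} {p : Fin n → ℝ}
    (hdesign : ∑ i, (p i : ℂ) • (proj (ψ i) ⊗ₖ proj (ψ i)) =
      (1 / ((d : ℂ) * (d + 1))) • (1 + swapMatrix d))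
    (A B : Matrix (Fin d) (Fin d) ℂ) :
    ∑ i, (p i : ℂ) * (proj (ψ i) * A).trace * (proj (ψ i) * B).trace =
      1 / ((d : ℂ) * (d + 1)) * (A.trace * B.trace + (A * B).trace) := by
  have h := congrArg (fun M => (M * (A ⊗ₖ B)).trace) hdesign
  simpa [Finset.sum_mul, trace_sum, Matrix.add_mul, trace_swapMatrix_mul_kronecker,
    ← mul_kronecker_mul, trace_kronecker, mul_assoc, mul_add] using h

/-- **Lemma 1.** For an ensemble forming a generalized 2-design,
every finite POVM `{E b}` and every family of density matrices `{σ b}`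
give average fidelity `∑ b i, p i * Tr(Π i E b) * Tr(Π i σ b) ≤ 2/(d+1)`. -/
theorem avg_fidelity_le_of_gen_two_design {d n : ℕ}
    (ψ : Fin n → Fin d → ℂ) (hψ : ∀ i, star (ψ i) ⬝ᵥ ψ i = 1)
    (p : Fin n → ℝ) (hp : ∀ i, 0 ≤ p i) (hp1 : ∑ i, p i = 1)
    (hdesign : ∑ i, (p i : ℂ) • (proj (ψ i) ⊗ₖ proj (ψ i)) =
      (1 / ((d : ℂ) * (d + 1))) • (1 + swapMatrix d))
    (m : ℕ) (E : Fin m → Matrix (Fin d) (Fin d) ℂ)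
    (hE : ∀ b, (E b).PosSemidef) (hEsum : ∑ b, E b = 1)
    (σ : Fin m → Matrix (Fin d) (Fin d) ℂ)
    (hσ : ∀ b, (σ b).PosSemidef) (hσtr : ∀ b, (σ b).trace = 1) :
    ∑ b, ∑ i, p i * (proj (ψ i) * E b).trace.re * (proj (ψ i) * σ b).trace.re ≤
      2 / ((d : ℝ) + 1) := by
  have hd : (d : ℝ) ≠ 0 := by
    rintro h
    obtain rfl : d = 0 := by exact_mod_cast h
    rcases isEmpty_or_nonempty (Fin n) with _ | ⟨⟨i⟩⟩
    · simp at hp1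
    · simpa using hψ i
  have hb (b : Fin m) :
      ∑ i, p i * (proj (ψ i) * E b).trace.re * (proj (ψ i) * σ b).trace.re ≤
        2 / ((d : ℝ) * (d + 1)) * (E b).trace.re := by
    have h := congrArg Complex.re (sum_trace_proj_mul_of_gen_two_design hdesign (E b) (σ b))
    have hc : 1 / ((d : ℂ) * (d + 1)) = ((1 / ((d : ℝ) * (d + 1)) : ℝ) : ℂ) := by push_cast; rfl
    have him (i : Fin n) := (isHermitian_proj (ψ i)).im_trace_mul (hE b).isHermitian
    rw [hc, hσtr, mul_one, Complex.re_ofReal_mul, Complex.add_re, Complex.re_sum] at h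
    simp only [mul_assoc, Complex.mul_re, him, zero_mul, sub_zero, Complex.ofReal_re,
      Complex.ofReal_im] at h
    have hle := (hE b).re_trace_mul_le (hσ b)
    rw [hσtr, Complex.one_re, mul_one] at hle
    simp only [mul_assoc, h]
    calc 1 / ((d : ℝ) * (d + 1)) * ((E b).trace.re + (E b * σ b).trace.re)
        ≤ 1 / ((d : ℝ) * (d + 1)) * ((E b).trace.re + (E b).trace.re) := by gcongr
      _ = 2 / ((d : ℝ) * (d + 1)) * (E b).trace.re := by ring
  have htr : ∑ b, (E b).trace.re = d := by
    rw [← Complex.re_sum, ← trace_sum, hEsum]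
    simp
  refine (Finset.sum_le_sum fun b _ => hb b).trans_eq ?_
  rw [← Finset.mul_sum, htr]
  field_simp
end

section
/- (Generalized 2-designs with d² elements are SIC-ensembles.) Let ψ_1, …, ψ_{d²} be unit vectors in ℂ^d with probability weights p_k ≥ 0 summing to 1 and Π_k = |ψ_k⟩⟨ψ_k|, and suppose the ensemble is a generalized 2-design: Σ_{k=1}^{d²} p_k (Π_k ⊗ Π_k) = (1/(d(d+1)))·(I + SWAP). Then p_k = 1/d² for every k, and |⟨ψ_j, ψ_k⟩|² = 1/(d+1) for all j ≠ k; that is, the ensemble is a symmetric informationally complete (SIC) ensemble. -/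
open Matrix Kronecker BigOperators

lemma proj_apply {d : ℕ} (ψ : Fin d → ℂ) (a b : Fin d) : proj ψ a b = ψ a * star (ψ b) := rfl

/-- Pairing `proj ψ` with `proj φ` under the trace gives the squared overlap of `φ` and `ψ`. -/
lemma sum_proj_mul_proj {d : ℕ} (φ ψ : Fin d → ℂ) :
    ∑ a, ∑ b, proj ψ b a * proj φ a b = ((‖star φ ⬝ᵥ ψ‖ ^ 2 : ℝ) : ℂ) := by
  have h : star (star φ ⬝ᵥ ψ) = ∑ a, φ a * star (ψ a) := by
    simp [dotProduct, mul_comm]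
  rw [Complex.ofReal_pow, ← Complex.mul_conj', ← Complex.star_def, h, mul_comm, dotProduct,
    Finset.sum_mul_sum]
  refine Finset.sum_congr rfl fun a _ => Finset.sum_congr rfl fun b _ => ?_
  simp only [proj_apply, Pi.star_apply]
  ring

/-- The diagonal entries of the projector onto a unit vector sum to one. -/
lemma sum_proj_diag {d : ℕ} {ψ : Fin d → ℂ} (hψ : star ψ ⬝ᵥ ψ = 1) :
    ∑ a, proj ψ a a = 1 := by
  simpa [dotProduct, proj_apply, mul_comm] using hψ

/-- Entrywise form of the generalized 2-design condition. -/
lemma design_apply {d : ℕ} {ι : Type*} [Fintype ι] (ψ : ι → Fin d → ℂ) (p : ι → ℝ)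
    (hdesign : ∑ k, (p k : ℂ) • (proj (ψ k) ⊗ₖ proj (ψ k)) =
      (1 / ((d : ℂ) * (d + 1))) • (1 + swapMatrix d)) (a b m n : Fin d) :
    ∑ k, (p k : ℂ) * (proj (ψ k) a b * proj (ψ k) n m) =
      (1 / ((d : ℂ) * (d + 1))) *
        ((if a = b ∧ n = m then 1 else 0) + (if a = m ∧ n = b then 1 else 0)) := by
  have h := congrFun (congrFun hdesign (a, n)) (b, m)
  simpa [Matrix.sum_apply, swapMatrix, Matrix.one_apply] using h

/-- A generalized 2-design of unit vectors is a generalized 1-design. -/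
lemma design_marginal {d : ℕ} {ι : Type*} [Fintype ι] (hd : d ≠ 0) (ψ : ι → Fin d → ℂ)
    (hψ : ∀ k, star (ψ k) ⬝ᵥ ψ k = 1) (p : ι → ℝ)
    (hdesign : ∑ k, (p k : ℂ) • (proj (ψ k) ⊗ₖ proj (ψ k)) =
      (1 / ((d : ℂ) * (d + 1))) • (1 + swapMatrix d)) (a b : Fin d) :
    ∑ k, (p k : ℂ) * proj (ψ k) a b = (1 / (d : ℂ)) * (if a = b then 1 else 0) := by
  have hd0 : (d : ℂ) ≠ 0 := by exact_mod_cast hd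
  have hd1 : (d : ℂ) + 1 ≠ 0 := by exact_mod_cast d.succ_ne_zero
  calc ∑ k, (p k : ℂ) * proj (ψ k) a b
      = ∑ k, ∑ n, (p k : ℂ) * (proj (ψ k) a b * proj (ψ k) n n) := by
        simp only [← Finset.mul_sum, sum_proj_diag (hψ _), mul_one]
    _ = ∑ n, (1 / ((d : ℂ) * (d + 1))) *
        ((if a = b ∧ n = n then 1 else 0) + (if a = n ∧ n = b then 1 else 0)) := by
        rw [Finset.sum_comm]
        exact Finset.sum_congr rfl fun n _ => design_apply ψ p hdesign a b n n
    _ = (1 / (d : ℂ)) * (if a = b then 1 else 0) := by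
        rw [← Finset.mul_sum, Finset.sum_add_distrib]
        by_cases hab : a = b
        · subst hab
          have h : ∀ n, (a = n ∧ n = a) ↔ a = n := fun n => ⟨And.left, fun h => ⟨h, h.symm⟩⟩
          simp [h]
          field_simp
        · have h : ∀ n, ¬ (a = n ∧ n = b) := fun n h => hab (h.1.trans h.2)
          simp [hab, h]

/-- In a generalized 2-design with `d²` elements, the projectors form a basis whose dual basis
is given explicitly by the design. -/
lemma design_dual_basis {d : ℕ} (hd : d ≠ 0)
    (ψ : Fin (d ^ 2) → Fin d → ℂ) (hψ : ∀ k, star (ψ k) ⬝ᵥ ψ k = 1) (p : Fin (d ^ 2) → ℝ)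
    (hdesign : ∑ k, (p k : ℂ) • (proj (ψ k) ⊗ₖ proj (ψ k)) =
      (1 / ((d : ℂ) * (d + 1))) • (1 + swapMatrix d)) (k j : Fin (d ^ 2)) :
    p k * (d * (d + 1) * ‖star (ψ j) ⬝ᵥ ψ k‖ ^ 2 - d) = if k = j then 1 else 0 := by
  have hd0 : (d : ℂ) ≠ 0 := by exact_mod_cast hd
  have hd1 : (d : ℂ) + 1 ≠ 0 := by exact_mod_cast d.succ_ne_zero
  let B : Matrix (Fin d × Fin d) (Fin (d ^ 2)) ℂ := Matrix.of fun x k => proj (ψ k) x.1 x.2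
  let C : Matrix (Fin (d ^ 2)) (Fin d × Fin d) ℂ := Matrix.of fun k x =>
    (p k : ℂ) * (d * (d + 1) * proj (ψ k) x.2 x.1 - d * (if x.1 = x.2 then 1 else 0))
  have hBC : B * C = 1 := by
    ext ⟨a, b⟩ ⟨m, n⟩
    calc ∑ k, B (a, b) k * C k (m, n)
        = d * (d + 1) * ∑ k, (p k : ℂ) * (proj (ψ k) a b * proj (ψ k) n m)
          - d * (if m = n then 1 else 0) * ∑ k, (p k : ℂ) * proj (ψ k) a b := by
          rw [Finset.mul_sum, Finset.mul_sum, ← Finset.sum_sub_distrib]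
          refine Finset.sum_congr rfl fun k _ => ?_
          simp only [B, C, Matrix.of_apply]
          ring
      _ = (1 : Matrix (Fin d × Fin d) (Fin d × Fin d) ℂ) (a, b) (m, n) := by
          rw [design_apply ψ p hdesign, design_marginal hd ψ hψ p hdesign, Matrix.one_apply]
          have h : (if a = b ∧ n = m then (1 : ℂ) else 0)
              = (if m = n then 1 else 0) * (if a = b then 1 else 0) := by
            by_cases hab : a = b <;> simp [hab, eq_comm]
          simp only [h, Prod.mk.injEq, @eq_comm _ b n]
          field_simp
          ring
  have hCB : C * B = 1 := (Matrix.mul_eq_one_comm_of_card_eq _ _ _ (by simp [sq])).1 hBC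
  have hkj : ∑ x, C k x * B x j = if k = j then 1 else 0 := by
    rw [← Matrix.mul_apply, hCB, Matrix.one_apply]
  have hsum : ∑ x, C k x * B x j
      = (p k : ℂ) * (d * (d + 1) * ((‖star (ψ j) ⬝ᵥ ψ k‖ ^ 2 : ℝ) : ℂ) - d) := by
    have htr : (p k : ℂ) * d
        = p k * d * ∑ a, ∑ b, (if a = b then (1 : ℂ) else 0) * proj (ψ j) a b := by
      simp [sum_proj_diag (hψ j)]
    rw [mul_sub, htr, ← sum_proj_mul_proj, Fintype.sum_prod_type]
    simp only [Finset.mul_sum, ← Finset.sum_sub_distrib]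
    refine Finset.sum_congr rfl fun a _ => Finset.sum_congr rfl fun b _ => ?_
    simp only [B, C, Matrix.of_apply]
    ring
  rw [hsum] at hkj
  apply Complex.ofReal_injective
  rw [apply_ite Complex.ofReal, Complex.ofReal_one, Complex.ofReal_zero]
  push_cast at hkj ⊢
  exact hkj

/-- A generalized 2-design consisting of `d²` unit vectors
is a SIC-ensemble: the weights are uniform, `p k = 1/d²`, and
`|⟨ψ j, ψ k⟩|² = 1/(d+1)` for all `j ≠ k`. -/
theorem gen_two_design_with_d_sq_elements_is_sic {d : ℕ}
    (ψ : Fin (d ^ 2) → Fin d → ℂ) (hψ : ∀ k, star (ψ k) ⬝ᵥ ψ k = 1)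
    (p : Fin (d ^ 2) → ℝ) (hp : ∀ k, 0 ≤ p k) (hp1 : ∑ k, p k = 1)
    (hdesign : ∑ k, (p k : ℂ) • (proj (ψ k) ⊗ₖ proj (ψ k)) =
      (1 / ((d : ℂ) * (d + 1))) • (1 + swapMatrix d)) :
    (∀ k, p k = 1 / (d : ℝ) ^ 2) ∧
    (∀ j k, j ≠ k → ‖star (ψ j) ⬝ᵥ ψ k‖ ^ 2 = 1 / ((d : ℝ) + 1)) := by
  have hd : d ≠ 0 := by
    rintro rfl
    simp at hp1
  have hd0 : (d : ℝ) ≠ 0 := by exact_mod_cast hd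
  have hd1 : (d : ℝ) + 1 ≠ 0 := by exact_mod_cast d.succ_ne_zero
  have key := design_dual_basis hd ψ hψ p hdesign
  have hweight : ∀ k, p k = 1 / (d : ℝ) ^ 2 := by
    intro k
    have h := key k k
    rw [hψ k, if_pos rfl, norm_one] at h
    rw [eq_div_iff (pow_ne_zero 2 hd0)]
    linear_combination h
  refine ⟨hweight, fun j k hjk => ?_⟩
  have h := key k j
  rw [if_neg hjk.symm, hweight k] at h
  have h' := (mul_eq_zero.1 h).resolve_left (one_div_ne_zero (pow_ne_zero 2 hd0))
  rw [eq_div_iff hd1]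
  apply mul_left_cancel₀ hd0
  linear_combination h'
end

section
/- Let n = d² and let p_1, …, p_n be nonnegative reals with Σ_k p_k = 1, and let λ_{jk} ∈ [0, 1] for j ≠ k be symmetric (λ_{jk} = λ_{kj}). Write α = Σ_k p_k². If Σ_{j≠k} p_j p_k λ_{jk} + α = 1/d, then Σ_{j≠k} p_j p_k λ_{jk}² + α ≥ 2/(d(d+1)), with equality if and only if p_k = 1/d² for all k and λ_{jk} = 1/(d+1) for all j ≠ k. -/
open BigOperators Finset

/-- The deviation of the quadratic overlap sum from `2/(d(d+1))` is a weighted sum of squares. -/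
theorem overlap_quadratic_sub_eq {d : ℕ} (hd : 0 < d)
    (p : Fin (d ^ 2) → ℝ) (hp1 : ∑ k, p k = 1) (l : Fin (d ^ 2) → Fin (d ^ 2) → ℝ)
    (hplane : ∑ j, ∑ k ∈ Finset.univ.erase j, p j * p k * l j k + ∑ k, (p k) ^ 2
      = 1 / (d : ℝ)) :
    ∑ j, ∑ k ∈ Finset.univ.erase j, p j * p k * (l j k) ^ 2 + ∑ k, (p k) ^ 2
        - 2 / ((d : ℝ) * (d + 1)) =
      ∑ j, ∑ k ∈ Finset.univ.erase j, p j * p k * (l j k - 1 / ((d : ℝ) + 1)) ^ 2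
        + (d / ((d : ℝ) + 1)) ^ 2 * ∑ k, (p k - 1 / (d : ℝ) ^ 2) ^ 2 := by
  have hd' : (0 : ℝ) < d := by exact_mod_cast hd
  have hoff : ∑ j, ∑ k ∈ Finset.univ.erase j, p j * p k = 1 - ∑ k, (p k) ^ 2 := by
    have h (j : Fin (d ^ 2)) : ∑ k ∈ Finset.univ.erase j, p j * p k = p j - (p j) ^ 2 := by
      rw [← Finset.mul_sum, Finset.sum_erase_eq_sub (Finset.mem_univ j), hp1]
      ring
    simp_rw [h, Finset.sum_sub_distrib, hp1]
  have hdiag : ∑ k, (p k - 1 / (d : ℝ) ^ 2) ^ 2 = ∑ k, (p k) ^ 2 - 1 / (d : ℝ) ^ 2 := by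
    have h (k : Fin (d ^ 2)) : (p k - 1 / (d : ℝ) ^ 2) ^ 2
        = (p k) ^ 2 - 2 / (d : ℝ) ^ 2 * p k + (1 / (d : ℝ) ^ 2) ^ 2 := by ring
    simp_rw [h, Finset.sum_add_distrib, Finset.sum_sub_distrib, ← Finset.mul_sum, hp1]
    simp only [Finset.sum_const, Finset.card_univ, Fintype.card_fin, nsmul_eq_mul, Nat.cast_pow]
    field_simp
    ring
  have hsq (t : ℝ) : ∑ j, ∑ k ∈ Finset.univ.erase j, p j * p k * (l j k - t) ^ 2
      = ∑ j, ∑ k ∈ Finset.univ.erase j, p j * p k * (l j k) ^ 2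
        - 2 * t * ∑ j, ∑ k ∈ Finset.univ.erase j, p j * p k * l j k
        + t ^ 2 * ∑ j, ∑ k ∈ Finset.univ.erase j, p j * p k := by
    simp_rw [Finset.mul_sum, ← Finset.sum_sub_distrib, ← Finset.sum_add_distrib]
    refine Finset.sum_congr rfl fun j _ => Finset.sum_congr rfl fun k _ => ?_
    ring
  rw [hsq, hoff, hdiag, eq_sub_of_add_eq hplane]
  field_simp
  ring

/-- With `n = d²` weights `p` summing to `1`, symmetric
overlaps `l j k ∈ [0,1]` for `j ≠ k`, and `α = ∑ k, (p k)²`,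
if `∑_{j≠k} p j * p k * l j k + α = 1/d` then
`∑_{j≠k} p j * p k * (l j k)² + α ≥ 2/(d(d+1))`, with equality iff
`p k = 1/d²` for all `k` and `l j k = 1/(d+1)` for all `j ≠ k`. -/
theorem overlap_quadratic_bound {d : ℕ}
    (p : Fin (d ^ 2) → ℝ) (hp : ∀ k, 0 ≤ p k) (hp1 : ∑ k, p k = 1)
    (l : Fin (d ^ 2) → Fin (d ^ 2) → ℝ)
    (hl01 : ∀ j k, j ≠ k → l j k ∈ Set.Icc (0 : ℝ) 1)
    (hlsymm : ∀ j k, l j k = l k j)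
    (hplane : ∑ j, ∑ k ∈ Finset.univ.erase j, p j * p k * l j k + ∑ k, (p k) ^ 2
      = 1 / (d : ℝ)) :
    (2 / ((d : ℝ) * (d + 1)) ≤
      ∑ j, ∑ k ∈ Finset.univ.erase j, p j * p k * (l j k) ^ 2 + ∑ k, (p k) ^ 2) ∧
    ((∑ j, ∑ k ∈ Finset.univ.erase j, p j * p k * (l j k) ^ 2 + ∑ k, (p k) ^ 2
        = 2 / ((d : ℝ) * (d + 1))) ↔
      ((∀ k, p k = 1 / (d : ℝ) ^ 2) ∧ ∀ j k, j ≠ k → l j k = 1 / ((d : ℝ) + 1))) := by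
  have hd : 0 < d := by
    rcases Nat.eq_zero_or_pos d with rfl | h
    · simp at hp1
    · exact h
  have hd' : (0 : ℝ) < d := by exact_mod_cast hd
  have key := overlap_quadratic_sub_eq hd p hp1 l hplane
  have hterm (j k : Fin (d ^ 2)) : 0 ≤ p j * p k * (l j k - 1 / ((d : ℝ) + 1)) ^ 2 :=
    mul_nonneg (mul_nonneg (hp j) (hp k)) (sq_nonneg _)
  have hrow (j : Fin (d ^ 2)) :
      0 ≤ ∑ k ∈ Finset.univ.erase j, p j * p k * (l j k - 1 / ((d : ℝ) + 1)) ^ 2 :=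
    Finset.sum_nonneg fun k _ => hterm j k
  have hoff := Finset.sum_nonneg fun j (_ : j ∈ Finset.univ) => hrow j
  have hdiag : 0 ≤ ∑ k, (p k - 1 / (d : ℝ) ^ 2) ^ 2 := Finset.sum_nonneg fun k _ => sq_nonneg _
  have hc : 0 < (d / ((d : ℝ) + 1)) ^ 2 := by positivity
  have hcdiag := mul_nonneg hc.le hdiag
  refine ⟨by linarith, fun heq => ?_, fun ⟨hpk, hljk⟩ => ?_⟩
  · rw [heq, sub_self] at key
    obtain ⟨hoff0, hcdiag0⟩ := (add_eq_zero_iff_of_nonneg hoff hcdiag).1 key.symm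
    have hdiag0 := (mul_eq_zero.1 hcdiag0).resolve_left hc.ne'
    have hpk (k : Fin (d ^ 2)) : p k = 1 / (d : ℝ) ^ 2 := by
      have h := (Finset.sum_eq_zero_iff_of_nonneg fun k _ => sq_nonneg _).1 hdiag0 k
        (Finset.mem_univ k)
      exact sub_eq_zero.1 (pow_eq_zero_iff two_ne_zero |>.1 h)
    have hpos (k : Fin (d ^ 2)) : 0 < p k := by
      rw [hpk]
      positivity
    refine ⟨hpk, fun j k hjk => ?_⟩
    have hj := (Finset.sum_eq_zero_iff_of_nonneg fun j _ => hrow j).1 hoff0 j (Finset.mem_univ j)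
    have h := (Finset.sum_eq_zero_iff_of_nonneg fun k _ => hterm j k).1 hj k
      (Finset.mem_erase.2 ⟨hjk.symm, Finset.mem_univ k⟩)
    have hsq := (mul_eq_zero.1 h).resolve_left (mul_pos (hpos j) (hpos k)).ne'
    exact sub_eq_zero.1 (pow_eq_zero_iff two_ne_zero |>.1 hsq)
  · have hoff0 : ∑ j, ∑ k ∈ Finset.univ.erase j,
        p j * p k * (l j k - 1 / ((d : ℝ) + 1)) ^ 2 = 0 := by
      refine Finset.sum_eq_zero fun j _ => Finset.sum_eq_zero fun k hk => ?_
      rw [hljk j k (Finset.ne_of_mem_erase hk).symm]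
      ring
    have hdiag0 : ∑ k, (p k - 1 / (d : ℝ) ^ 2) ^ 2 = 0 :=
      Finset.sum_eq_zero fun k _ => by rw [hpk k]; ring
    rw [hoff0, hdiag0, mul_zero, add_zero] at key
    exact sub_eq_zero.1 key
end

section
/- Let μ be the uniform (normalized) probability measure on the unit sphere of ℂ^d. Then for every unit vector φ in ℂ^d, ∫ |⟨φ, ψ⟩|⁴ dμ(ψ) = 2/(d(d+1)). Consequently, d · ∫ |⟨φ, ψ⟩|⁴ dμ(ψ) = 2/(d+1). -/
open Matrix BigOperators MeasureTheory

lemma star_dotProduct_self_eq_sum_norm_sq {ι : Type*} [Fintype ι] (ψ : ι → ℂ) :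
    star ψ ⬝ᵥ ψ = ((∑ i, ‖ψ i‖ ^ 2 : ℝ) : ℂ) := by
  simp [dotProduct, Complex.conj_mul']

lemma sum_norm_sq_eq_one_of_star_dotProduct_self {ι : Type*} [Fintype ι] {ψ : ι → ℂ}
    (h : star ψ ⬝ᵥ ψ = 1) : ∑ i, ‖ψ i‖ ^ 2 = 1 := by
  rw [star_dotProduct_self_eq_sum_norm_sq] at h
  exact_mod_cast h

/-- Every unit vector is, up to conjugation, a prescribed row of some unitary matrix. -/
lemma exists_unitary_mulVec_apply_eq {ι : Type*} [Fintype ι] [DecidableEq ι] (φ : ι → ℂ)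
    (hφ : star φ ⬝ᵥ φ = 1) (i : ι) :
    ∃ U : Matrix.unitaryGroup ι ℂ, ∀ ψ : ι → ℂ,
      ((U : Matrix ι ι ℂ) *ᵥ ψ) i = star φ ⬝ᵥ ψ := by
  have hnorm : ‖WithLp.toLp 2 φ‖ = 1 := by
    rw [EuclideanSpace.norm_eq, sum_norm_sq_eq_one_of_star_dotProduct_self hφ, Real.sqrt_one]
  have horth : Orthonormal ℂ
      (({i} : Set ι).domRestrict fun _ : ι => (WithLp.toLp 2 φ : EuclideanSpace ℂ ι)) :=
    ⟨fun _ => hnorm, fun a b hab => (hab (Subsingleton.elim a b)).elim⟩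
  obtain ⟨b, hb⟩ := horth.exists_orthonormalBasis_extension_of_card_eq (by simp)
  refine ⟨star ⟨_, (EuclideanSpace.basisFun ι ℂ).toMatrix_orthonormalBasis_mem_unitary b⟩,
    fun ψ => ?_⟩
  simp [mulVec, dotProduct, star_apply, Module.Basis.toMatrix_apply, hb i rfl]

lemma integrable_of_continuous_of_ae_star_dotProduct_self {ι : Type*} [Fintype ι]
    (μ : Measure (ι → ℂ)) [IsFiniteMeasure μ] (hsph : ∀ᵐ ψ ∂μ, star ψ ⬝ᵥ ψ = 1)
    {f : (ι → ℂ) → ℝ} (hf : Continuous f) : Integrable f μ := by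
  have hball : ∀ᵐ ψ ∂μ, ψ ∈ Metric.closedBall (0 : ι → ℂ) 1 := by
    filter_upwards [hsph] with ψ hψ
    rw [mem_closedBall_zero_iff, pi_norm_le_iff_of_nonneg zero_le_one]
    intro i
    have h := Finset.single_le_sum (f := fun i => ‖ψ i‖ ^ 2) (fun i _ => sq_nonneg _)
      (Finset.mem_univ i)
    rw [sum_norm_sq_eq_one_of_star_dotProduct_self hψ] at h
    exact (sq_le_one_iff₀ (norm_nonneg _)).mp h
  have h := hf.continuousOn.integrableOn_compact (μ := μ)
    (isCompact_closedBall (0 : ι → ℂ) 1)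
  rwa [IntegrableOn, Measure.restrict_eq_self_of_ae_mem hball] at h

lemma sum_norm_add_mul_pow_four (a b : ℂ) :
    ‖a + 1 * b‖ ^ 4 + ‖a + (-1) * b‖ ^ 4 + ‖a + Complex.I * b‖ ^ 4 +
      ‖a + (-Complex.I) * b‖ ^ 4 =
    4 * (‖a‖ ^ 4 + ‖b‖ ^ 4 + 4 * (‖a‖ ^ 2 * ‖b‖ ^ 2)) := by
  have h (z : ℂ) : ‖z‖ ^ 4 = (z.re * z.re + z.im * z.im) ^ 2 := by
    rw [← Complex.normSq_apply, Complex.normSq_eq_norm_sq]; ring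
  simp only [h, Complex.sq_norm, Complex.normSq_apply]
  simp
  ring

section InvariantMeasure

variable {ι : Type*} [Fintype ι] [DecidableEq ι] {μ : Measure (ι → ℂ)}

lemma integral_norm_star_dotProduct_pow_four_eq
    (hinv : ∀ U : Matrix.unitaryGroup ι ℂ,
      μ.map (fun ψ => (U : Matrix ι ι ℂ) *ᵥ ψ) = μ)
    {φ : ι → ℂ} (hφ : star φ ⬝ᵥ φ = 1) (i : ι) :
    ∫ ψ, ‖star φ ⬝ᵥ ψ‖ ^ 4 ∂μ = ∫ ψ, ‖ψ i‖ ^ 4 ∂μ := by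
  obtain ⟨U, hU⟩ := exists_unitary_mulVec_apply_eq φ hφ i
  have hc : Continuous fun ψ : ι → ℂ => (U : Matrix ι ι ℂ) *ᵥ ψ := by fun_prop
  have hg : Continuous fun ψ : ι → ℂ => ‖ψ i‖ ^ 4 := by fun_prop
  conv_rhs => rw [← hinv U]
  rw [integral_map hc.aemeasurable hg.aestronglyMeasurable]
  simp only [hU]

lemma integral_norm_add_mul_pow_four
    (hinv : ∀ U : Matrix.unitaryGroup ι ℂ,
      μ.map (fun ψ => (U : Matrix ι ι ℂ) *ᵥ ψ) = μ)
    {i j : ι} (hij : i ≠ j) {w : ℂ} (hw : ‖w‖ = 1) (k : ι) :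
    ∫ ψ, ‖ψ i + w * ψ j‖ ^ 4 ∂μ = 4 * ∫ ψ, ‖ψ k‖ ^ 4 ∂μ := by
  have hs : ((√2 : ℝ) : ℂ) * ((√2 : ℝ) : ℂ) = 2 := by
    rw [← Complex.ofReal_mul, Real.mul_self_sqrt (by norm_num)]; norm_num
  have hs0 : ((√2 : ℝ) : ℂ) ≠ 0 := by simp
  have hww : w * star w = 1 := by simp [Complex.mul_conj', hw]
  let φ : ι → ℂ := ((√2 : ℝ) : ℂ)⁻¹ • (Pi.single i 1 + Pi.single j (star w))
  have hφψ (ψ : ι → ℂ) : star φ ⬝ᵥ ψ = ((√2 : ℝ) : ℂ)⁻¹ * (ψ i + w * ψ j) := by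
    simp [φ, add_dotProduct, mul_add]
  have hφ : star φ ⬝ᵥ φ = 1 := by
    rw [hφψ]
    simp only [φ, Pi.smul_apply, Pi.add_apply, Pi.single_eq_same, Pi.single_eq_of_ne hij,
      Pi.single_eq_of_ne hij.symm, smul_eq_mul]
    field_simp
    linear_combination hww - hs
  rw [← integral_norm_star_dotProduct_pow_four_eq hinv hφ k, ← integral_const_mul]
  refine integral_congr_ae (.of_forall fun ψ => ?_)
  have h4 : √2 ^ 4 = 4 := by
    rw [show √2 ^ 4 = (√2 ^ 2) ^ 2 by ring, Real.sq_sqrt (by norm_num)]; norm_num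
  simp only [hφψ, norm_mul, norm_inv, Complex.norm_real, mul_pow, inv_pow, Real.norm_eq_abs,
    abs_of_nonneg (Real.sqrt_nonneg 2), h4]
  ring

lemma integral_norm_sq_mul_norm_sq [IsFiniteMeasure μ] (hsph : ∀ᵐ ψ ∂μ, star ψ ⬝ᵥ ψ = 1)
    (hinv : ∀ U : Matrix.unitaryGroup ι ℂ,
      μ.map (fun ψ => (U : Matrix ι ι ℂ) *ᵥ ψ) = μ)
    {i j : ι} (hij : i ≠ j) (k : ι) :
    ∫ ψ, ‖ψ i‖ ^ 2 * ‖ψ j‖ ^ 2 ∂μ = (∫ ψ, ‖ψ k‖ ^ 4 ∂μ) / 2 := by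
  have hint {f : (ι → ℂ) → ℝ} (hf : Continuous f) : Integrable f μ :=
    integrable_of_continuous_of_ae_star_dotProduct_self μ hsph hf
  have hcoord (l : ι) : ∫ ψ, ‖ψ l‖ ^ 4 ∂μ = ∫ ψ, ‖ψ k‖ ^ 4 ∂μ := by
    have hl : star (Pi.single l 1 : ι → ℂ) ⬝ᵥ Pi.single l 1 = 1 := by simp
    rw [← integral_norm_star_dotProduct_pow_four_eq hinv hl l,
      integral_norm_star_dotProduct_pow_four_eq hinv hl k]
  have h := integral_congr_ae (μ := μ)
    (.of_forall fun ψ : ι → ℂ => sum_norm_add_mul_pow_four (ψ i) (ψ j))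
  rw [integral_add (hint (by fun_prop)) (hint (by fun_prop)),
    integral_add (hint (by fun_prop)) (hint (by fun_prop)),
    integral_add (hint (by fun_prop)) (hint (by fun_prop)),
    integral_const_mul,
    integral_add (hint (by fun_prop)) (hint (by fun_prop)),
    integral_add (hint (by fun_prop)) (hint (by fun_prop)),
    integral_const_mul, hcoord i, hcoord j,
    integral_norm_add_mul_pow_four hinv hij (by simp) k,
    integral_norm_add_mul_pow_four hinv hij (by simp) k,
    integral_norm_add_mul_pow_four hinv hij (by simp) k,
    integral_norm_add_mul_pow_four hinv hij (by simp) k] at h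
  linarith

lemma card_mul_card_add_one_mul_integral_norm_pow_four [IsProbabilityMeasure μ]
    (hsph : ∀ᵐ ψ ∂μ, star ψ ⬝ᵥ ψ = 1)
    (hinv : ∀ U : Matrix.unitaryGroup ι ℂ,
      μ.map (fun ψ => (U : Matrix ι ι ℂ) *ᵥ ψ) = μ) (k : ι) :
    (Fintype.card ι : ℝ) * (Fintype.card ι + 1) * ∫ ψ, ‖ψ k‖ ^ 4 ∂μ = 2 := by
  have hint {f : (ι → ℂ) → ℝ} (hf : Continuous f) : Integrable f μ :=
    integrable_of_continuous_of_ae_star_dotProduct_self μ hsph hf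
  have hpair (i j : ι) : ∫ ψ, ‖ψ i‖ ^ 2 * ‖ψ j‖ ^ 2 ∂μ =
      (∫ ψ, ‖ψ k‖ ^ 4 ∂μ) / 2 + if i = j then (∫ ψ, ‖ψ k‖ ^ 4 ∂μ) / 2 else 0 := by
    split_ifs with hij
    · subst hij
      have hl : star (Pi.single i 1 : ι → ℂ) ⬝ᵥ Pi.single i 1 = 1 := by simp
      rw [add_halves, ← integral_norm_star_dotProduct_pow_four_eq hinv hl k,
        integral_norm_star_dotProduct_pow_four_eq hinv hl i]
      simp only [← pow_add]
    · rw [integral_norm_sq_mul_norm_sq hsph hinv hij k, add_zero]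
  have hone : ∫ ψ, ∑ i, ∑ j, ‖ψ i‖ ^ 2 * ‖ψ j‖ ^ 2 ∂μ = 1 := by
    have hae : ∀ᵐ ψ ∂μ, ∑ i, ∑ j, ‖ψ i‖ ^ 2 * ‖ψ j‖ ^ 2 = (1 : ℝ) := by
      filter_upwards [hsph] with ψ hψ
      rw [← Finset.sum_mul_sum, sum_norm_sq_eq_one_of_star_dotProduct_self hψ, one_mul]
    rw [integral_congr_ae hae]
    simp
  rw [integral_finsetSum _ fun i _ => hint (by fun_prop)] at hone
  have hinner (i : ι) : ∫ ψ, ∑ j, ‖ψ i‖ ^ 2 * ‖ψ j‖ ^ 2 ∂μ =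
      ∑ j, ∫ ψ, ‖ψ i‖ ^ 2 * ‖ψ j‖ ^ 2 ∂μ :=
    integral_finsetSum _ fun j _ => hint (by fun_prop)
  simp_rw [hinner, hpair, Finset.sum_add_distrib] at hone
  simp at hone
  linarith

end InvariantMeasure

/-- Let `μ` be the uniform probability measure on the unit
sphere of `ℂ^d` (a probability measure concentrated on unit vectors and
invariant under every unitary). Then for every unit vector `φ`,
`∫ |⟨φ, ψ⟩|⁴ dμ(ψ) = 2/(d(d+1))`, and consequently
`d * ∫ |⟨φ, ψ⟩|⁴ dμ(ψ) = 2/(d+1)`. -/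
theorem integral_inner_pow_four_sphere {d : ℕ}
    (μ : Measure (Fin d → ℂ)) [IsProbabilityMeasure μ]
    (hsph : ∀ᵐ ψ ∂μ, star ψ ⬝ᵥ ψ = 1)
    (hinv : ∀ U : Matrix.unitaryGroup (Fin d) ℂ,
      μ.map (fun ψ => (U : Matrix (Fin d) (Fin d) ℂ) *ᵥ ψ) = μ)
    (φ : Fin d → ℂ) (hφ : star φ ⬝ᵥ φ = 1) :
    (∫ ψ, ‖star φ ⬝ᵥ ψ‖ ^ 4 ∂μ) = 2 / ((d : ℝ) * (d + 1)) ∧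
    (d : ℝ) * (∫ ψ, ‖star φ ⬝ᵥ ψ‖ ^ 4 ∂μ) = 2 / ((d : ℝ) + 1) := by
  have hd : d ≠ 0 := by
    rintro rfl
    simp at hφ
  let k : Fin d := ⟨0, Nat.pos_of_ne_zero hd⟩
  have hd' : (d : ℝ) ≠ 0 := Nat.cast_ne_zero.mpr hd
  have hd1 : (d : ℝ) + 1 ≠ 0 := by positivity
  have h := card_mul_card_add_one_mul_integral_norm_pow_four hsph hinv k
  rw [Fintype.card_fin, ← integral_norm_star_dotProduct_pow_four_eq hinv hφ k] at h
  constructor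
  · rw [eq_div_iff (mul_ne_zero hd' hd1)]
    linarith
  · rw [eq_div_iff hd1]
    linarith
end

section
/- Let μ be the uniform (normalized) probability measure on the unit sphere of ℂ^d, and for a unit vector ψ write P_ψ = |ψ⟩⟨ψ|. Then ∫ (P_ψ ⊗ P_ψ) dμ(ψ) = (1/(d(d+1)))·(I + SWAP) = (2/(d(d+1)))·Π_sym, where SWAP is the swap operator on ℂ^d ⊗ ℂ^d and Π_sym = (I + SWAP)/2 is the projector onto the symmetric subspace. -/
open Matrix BigOperators MeasureTheory

/-- The integral of a continuous function against a measure invariant under a linear map `U` does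
not change when composed with `U`. -/
lemma integral_comp_mulVec_of_map_eq {d : ℕ} {μ : Measure (Fin d → ℂ)}
    {U : Matrix (Fin d) (Fin d) ℂ} (hU : μ.map (fun ψ => U *ᵥ ψ) = μ)
    {f : (Fin d → ℂ) → ℂ} (hf : Continuous f) :
    ∫ ψ, f (U *ᵥ ψ) ∂μ = ∫ ψ, f ψ ∂μ := by
  have hc : Continuous fun ψ : Fin d → ℂ => U *ᵥ ψ := continuous_const.matrix_mulVec continuous_id
  conv_rhs => rw [← hU]
  exact (integral_map hc.aemeasurable hf.aestronglyMeasurable).symm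

lemma sum_mul_conj_of_star_dotProduct {d : ℕ} {ψ : Fin d → ℂ} (h : star ψ ⬝ᵥ ψ = 1) :
    ∑ i, ψ i * (starRingEnd ℂ) (ψ i) = 1 := by
  rw [← h]
  simp [dotProduct, mul_comm]

lemma norm_apply_le_one_of_star_dotProduct {d : ℕ} {ψ : Fin d → ℂ} (h : star ψ ⬝ᵥ ψ = 1)
    (i : Fin d) : ‖ψ i‖ ≤ 1 := by
  have h1 : ∑ i, ‖ψ i‖ ^ 2 = 1 := by
    have h2 := sum_mul_conj_of_star_dotProduct h
    simp only [Complex.mul_conj'] at h2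
    exact_mod_cast h2
  have h3 : ‖ψ i‖ ^ 2 ≤ ∑ i, ‖ψ i‖ ^ 2 :=
    Finset.single_le_sum (f := fun i => ‖ψ i‖ ^ 2) (fun _ _ => by positivity) (Finset.mem_univ i)
  nlinarith [norm_nonneg (ψ i)]

/-- The `((i, j), (k, l))` entry of `P_ψ ⊗ P_ψ`. -/
def projTensorEntry {d : ℕ} (i j k l : Fin d) (ψ : Fin d → ℂ) : ℂ :=
  (ψ i * (starRingEnd ℂ) (ψ k)) * (ψ j * (starRingEnd ℂ) (ψ l))

lemma continuous_projTensorEntry {d : ℕ} (i j k l : Fin d) :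
    Continuous (projTensorEntry i j k l) := by
  have h (i : Fin d) : Continuous fun ψ : Fin d → ℂ => (starRingEnd ℂ) (ψ i) :=
    Complex.continuous_conj.comp (continuous_apply i)
  exact ((continuous_apply i).mul (h k)).mul ((continuous_apply j).mul (h l))

lemma integrable_projTensorEntry {d : ℕ} {μ : Measure (Fin d → ℂ)} [IsProbabilityMeasure μ]
    (hsph : ∀ᵐ ψ ∂μ, star ψ ⬝ᵥ ψ = 1) (i j k l : Fin d) :
    Integrable (projTensorEntry i j k l) μ := by
  refine Integrable.of_bound (continuous_projTensorEntry i j k l).aestronglyMeasurable 1 ?_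
  filter_upwards [hsph] with ψ hψ
  have h := norm_apply_le_one_of_star_dotProduct hψ
  simp only [projTensorEntry, norm_mul, RCLike.norm_conj]
  exact mul_le_one₀ (mul_le_one₀ (h i) (norm_nonneg _) (h k)) (by positivity)
    (mul_le_one₀ (h j) (norm_nonneg _) (h l))

/-- The diagonal unitary multiplying the coordinate `a` by `Complex.I`. -/
lemma diagonal_update_I_mem_unitaryGroup {d : ℕ} (a : Fin d) :
    diagonal (Function.update (1 : Fin d → ℂ) a Complex.I) ∈ unitaryGroup (Fin d) ℂ := by
  rw [mem_unitaryGroup_iff, star_eq_conjTranspose, diagonal_conjTranspose, diagonal_mul_diagonal,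
    ← diagonal_one]
  congr 1
  ext i
  rcases eq_or_ne i a with rfl | h
  · simp
  · simp [h]

lemma permMatrix_swap_mul_self {d : ℕ} (a b : Fin d) :
    (Equiv.swap a b).permMatrix ℂ * (Equiv.swap a b).permMatrix ℂ = 1 := by
  rw [← permMatrix_mul, Equiv.swap_mul_self, permMatrix_one]

lemma conjTranspose_permMatrix_swap {d : ℕ} (a b : Fin d) :
    ((Equiv.swap a b).permMatrix ℂ)ᴴ = (Equiv.swap a b).permMatrix ℂ := by
  rw [conjTranspose_permMatrix, Equiv.swap_inv]

lemma permMatrix_swap_mem_unitaryGroup {d : ℕ} (a b : Fin d) :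
    (Equiv.swap a b).permMatrix ℂ ∈ unitaryGroup (Fin d) ℂ := by
  rw [mem_unitaryGroup_iff, star_eq_conjTranspose, conjTranspose_permMatrix_swap,
    permMatrix_swap_mul_self]

/-- The square root of a swap, up to a phase. -/
lemma one_add_I_smul_permMatrix_swap_mem_unitaryGroup {d : ℕ} (a b : Fin d) :
    ((√2 : ℝ) : ℂ)⁻¹ • (1 + Complex.I • (Equiv.swap a b).permMatrix ℂ) ∈
      unitaryGroup (Fin d) ℂ := by
  have h2 : ((√2 : ℝ) : ℂ)⁻¹ * ((√2 : ℝ) : ℂ)⁻¹ = 2⁻¹ := by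
    rw [← mul_inv, ← Complex.ofReal_mul, Real.mul_self_sqrt (by norm_num)]
    norm_num
  rw [mem_unitaryGroup_iff, star_eq_conjTranspose, conjTranspose_smul, conjTranspose_add,
    conjTranspose_smul, conjTranspose_permMatrix_swap, conjTranspose_one]
  simp only [star_inv₀, RCLike.star_def, Complex.conj_ofReal, Complex.conj_I, smul_mul_smul_comm,
    h2, add_mul, mul_add, one_mul, mul_one, permMatrix_swap_mul_self, mul_neg, Complex.I_mul_I,
    one_smul, neg_smul]
  module

/-- Invariance of a measure on `ℂ^d` under the unitary group. -/
def IsUnitarilyInvariant {d : ℕ} (μ : Measure (Fin d → ℂ)) : Prop :=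
  ∀ U : Matrix.unitaryGroup (Fin d) ℂ,
    μ.map (fun ψ => (U : Matrix (Fin d) (Fin d) ℂ) *ᵥ ψ) = μ

namespace IsUnitarilyInvariant

lemma integral_projTensorEntry_comp_mulVec {d : ℕ} {μ : Measure (Fin d → ℂ)}
    (hinv : IsUnitarilyInvariant μ) {U : Matrix (Fin d) (Fin d) ℂ}
    (hU : U ∈ unitaryGroup (Fin d) ℂ) (i j k l : Fin d) :
    ∫ ψ, projTensorEntry i j k l (U *ᵥ ψ) ∂μ = ∫ ψ, projTensorEntry i j k l ψ ∂μ :=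
  integral_comp_mulVec_of_map_eq (hinv ⟨U, hU⟩) (continuous_projTensorEntry i j k l)

lemma integral_projTensorEntry_eq_zero {d : ℕ} {μ : Measure (Fin d → ℂ)}
    (hinv : IsUnitarilyInvariant μ) {i j k l : Fin d} (h₁ : ¬(i = k ∧ j = l))
    (h₂ : ¬(i = l ∧ j = k)) : ∫ ψ, projTensorEntry i j k l ψ ∂μ = 0 := by
  have key (a : Fin d) : projTensorEntry i j k l (Function.update 1 a Complex.I) = 1 ∨
      ∫ ψ, projTensorEntry i j k l ψ ∂μ = 0 := by
    have h := hinv.integral_projTensorEntry_comp_mulVec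
      (diagonal_update_I_mem_unitaryGroup a) i j k l
    have hmul (ψ : Fin d → ℂ) : projTensorEntry i j k l
        (diagonal (Function.update (1 : Fin d → ℂ) a Complex.I) *ᵥ ψ) =
        projTensorEntry i j k l (Function.update 1 a Complex.I) *
          projTensorEntry i j k l ψ := by
      simp only [projTensorEntry, mulVec_diagonal, map_mul]
      ring
    simp only [hmul, integral_const_mul] at h
    exact or_iff_not_imp_right.mpr fun h0 => mul_right_cancel₀ h0 (h.trans (one_mul _).symm)
  have hI : (Complex.I : ℂ) ≠ 1 := by simp [Complex.ext_iff]
  have hII : (-1 : ℂ) ≠ 1 := by norm_num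
  by_cases hik : i = k
  · subst hik
    have hjl : l ≠ j := fun h => h₁ ⟨rfl, h.symm⟩
    refine (key j).resolve_left ?_
    rcases eq_or_ne i j with rfl | hij <;> simp [projTensorEntry, *]
  · by_cases hil : i = l
    · subst hil
      have hjk : k ≠ j := fun h => h₂ ⟨rfl, h.symm⟩
      refine (key j).resolve_left ?_
      rcases eq_or_ne i j with rfl | hij <;> simp [projTensorEntry, *]
    · refine (key i).resolve_left ?_
      rcases eq_or_ne j i with rfl | hij <;>
        simp [projTensorEntry, Ne.symm hik, Ne.symm hil, *]

lemma integral_projTensorEntry_self_eq {d : ℕ} {μ : Measure (Fin d → ℂ)}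
    (hinv : IsUnitarilyInvariant μ) (a b : Fin d) :
    ∫ ψ, projTensorEntry a a a a ψ ∂μ = ∫ ψ, projTensorEntry b b b b ψ ∂μ := by
  rw [← hinv.integral_projTensorEntry_comp_mulVec (permMatrix_swap_mem_unitaryGroup a b)]
  simp [projTensorEntry, permMatrix_mulVec]

lemma integral_projTensorEntry_of_ne {d : ℕ} {μ : Measure (Fin d → ℂ)} [IsProbabilityMeasure μ]
    (hinv : IsUnitarilyInvariant μ) (hsph : ∀ᵐ ψ ∂μ, star ψ ⬝ᵥ ψ = 1) {a b : Fin d}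
    (hab : a ≠ b) :
    ∫ ψ, projTensorEntry a b a b ψ ∂μ = (∫ ψ, projTensorEntry a a a a ψ ∂μ) / 2 := by
  have hs : ((√2 : ℝ) : ℂ)⁻¹ ^ 4 = 4⁻¹ := by
    rw [inv_pow, ← Complex.ofReal_pow, show (√2 : ℝ) ^ 4 = (√2 ^ 2) ^ 2 by ring,
      Real.sq_sqrt (by norm_num)]
    norm_num
  have hpt (ψ : Fin d → ℂ) : projTensorEntry a b a b
      ((((√2 : ℝ) : ℂ)⁻¹ • (1 + Complex.I • (Equiv.swap a b).permMatrix ℂ)) *ᵥ ψ) =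
      4⁻¹ * (projTensorEntry a a a a ψ + projTensorEntry b b b b ψ +
        (projTensorEntry a a b b ψ + projTensorEntry b b a a ψ)) := by
    simp only [projTensorEntry, smul_mulVec, add_mulVec, one_mulVec, permMatrix_mulVec,
      Pi.smul_apply, Pi.add_apply, Function.comp_apply, Equiv.swap_apply_left,
      Equiv.swap_apply_right, smul_eq_mul, map_mul, map_add, map_inv₀, Complex.conj_ofReal,
      Complex.conj_I]
    rw [← hs]
    have hP : (ψ a + Complex.I * ψ b) * (ψ b + Complex.I * ψ a) =
        Complex.I * (ψ a ^ 2 + ψ b ^ 2) := by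
      linear_combination ψ a * ψ b * Complex.I_sq
    have hQ (x y : ℂ) : (x + -Complex.I * y) * (y + -Complex.I * x) =
        -Complex.I * (x ^ 2 + y ^ 2) := by
      linear_combination x * y * Complex.I_sq
    generalize (starRingEnd ℂ) (ψ a) = x
    generalize (starRingEnd ℂ) (ψ b) = y
    linear_combination ((√2 : ℝ) : ℂ)⁻¹ ^ 4 *
      ((x + -Complex.I * y) * (y + -Complex.I * x) * hP +
        Complex.I * (ψ a ^ 2 + ψ b ^ 2) * hQ x y -
        (ψ a ^ 2 + ψ b ^ 2) * (x ^ 2 + y ^ 2) * Complex.I_sq)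
  have hint := integrable_projTensorEntry hsph
  have hdiag : Integrable (fun ψ => projTensorEntry a a a a ψ + projTensorEntry b b b b ψ) μ :=
    (hint a a a a).add (hint b b b b)
  have hoff : Integrable (fun ψ => projTensorEntry a a b b ψ + projTensorEntry b b a a ψ) μ :=
    (hint a a b b).add (hint b b a a)
  rw [← hinv.integral_projTensorEntry_comp_mulVec
      (one_add_I_smul_permMatrix_swap_mem_unitaryGroup a b)]
  simp only [hpt]
  rw [integral_const_mul, integral_add hdiag hoff,
    integral_add (hint a a a a) (hint b b b b), integral_add (hint a a b b) (hint b b a a),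
    hinv.integral_projTensorEntry_eq_zero (i := a) (j := a) (k := b) (l := b)
      (by simp [hab]) (by simp [hab]),
    hinv.integral_projTensorEntry_eq_zero (i := b) (j := b) (k := a) (l := a)
      (by simp [hab.symm]) (by simp [hab.symm]),
    hinv.integral_projTensorEntry_self_eq b a]
  ring

lemma integral_projTensorEntry_diag {d : ℕ} {μ : Measure (Fin d → ℂ)} [IsProbabilityMeasure μ]
    (hinv : IsUnitarilyInvariant μ) (hsph : ∀ᵐ ψ ∂μ, star ψ ⬝ᵥ ψ = 1) (a b : Fin d) :
    ∫ ψ, projTensorEntry a b a b ψ ∂μ =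
      (1 / ((d : ℂ) * (d + 1))) * (1 + if a = b then 1 else 0) := by
  set c := ∫ ψ, projTensorEntry a a a a ψ ∂μ with hc
  have hval (i j : Fin d) :
      ∫ ψ, projTensorEntry i j i j ψ ∂μ = c / 2 * (1 + if i = j then 1 else 0) := by
    rw [hc, hinv.integral_projTensorEntry_self_eq a i]
    rcases eq_or_ne i j with rfl | hij
    · simp only [if_true]
      ring
    · simp [hinv.integral_projTensorEntry_of_ne hsph hij, hij]
  have hsum : ∑ i, ∑ j, ∫ ψ, projTensorEntry i j i j ψ ∂μ = 1 := by
    have hint := integrable_projTensorEntry hsph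
    simp_rw [← integral_finsetSum Finset.univ fun j _ => hint _ j _ j]
    rw [← integral_finsetSum Finset.univ fun i _ =>
      integrable_finsetSum Finset.univ fun j _ => hint i j i j]
    have h1 : (fun ψ => ∑ i, ∑ j, projTensorEntry i j i j ψ) =ᵐ[μ] fun _ => 1 := by
      filter_upwards [hsph] with ψ hψ
      simp only [projTensorEntry]
      rw [← Finset.sum_mul_sum, sum_mul_conj_of_star_dotProduct hψ, one_mul]
    rw [integral_congr_ae h1]
    simp
  have hd : (d : ℂ) ≠ 0 := by
    have := a.pos
    exact_mod_cast this.ne'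
  have hd1 : (d : ℂ) + 1 ≠ 0 := by exact_mod_cast d.succ_ne_zero
  simp only [hval, ← Finset.mul_sum, Finset.sum_add_distrib, Finset.sum_ite_eq, Finset.mem_univ,
    if_true, Finset.sum_const, Finset.card_univ, Fintype.card_fin, nsmul_eq_mul, mul_one] at hsum
  rw [hval]
  congr 1
  field_simp
  linear_combination 2 * hsum

end IsUnitarilyInvariant

/-- Let `μ` be the uniform probability measure on the unit
sphere of `ℂ^d`. Then, entrywise, `∫ (P_ψ ⊗ P_ψ) dμ(ψ) = (1/(d(d+1)))·(I + SWAP)`: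
the `((i,j),(k,l))` entry of `P_ψ ⊗ P_ψ` is `ψ i * conj (ψ k) * (ψ j * conj (ψ l))`,
the corresponding entry of `I` is `δ_{ik} δ_{jl}` and of `SWAP` is `δ_{il} δ_{jk}`.
Equivalently the right-hand side is `(2/(d(d+1)))·Π_sym` with `Π_sym = (I + SWAP)/2`. -/
theorem integral_proj_tensor_proj_sphere {d : ℕ}
    (μ : Measure (Fin d → ℂ)) [IsProbabilityMeasure μ]
    (hsph : ∀ᵐ ψ ∂μ, star ψ ⬝ᵥ ψ = 1)
    (hinv : ∀ U : Matrix.unitaryGroup (Fin d) ℂ,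
      μ.map (fun ψ => (U : Matrix (Fin d) (Fin d) ℂ) *ᵥ ψ) = μ) :
    ∀ i j k l : Fin d,
      (∫ ψ, (ψ i * (starRingEnd ℂ) (ψ k)) * (ψ j * (starRingEnd ℂ) (ψ l)) ∂μ) =
        (1 / ((d : ℂ) * (d + 1))) *
          ((if i = k ∧ j = l then 1 else 0) + (if i = l ∧ j = k then 1 else 0)) := by
  intro i j k l
  have hinv : IsUnitarilyInvariant μ := hinv
  change ∫ ψ, projTensorEntry i j k l ψ ∂μ = _
  by_cases h₁ : i = k ∧ j = l
  · obtain ⟨rfl, rfl⟩ := h₁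
    rw [hinv.integral_projTensorEntry_diag hsph]
    simp [eq_comm]
  by_cases h₂ : i = l ∧ j = k
  · obtain ⟨rfl, rfl⟩ := h₂
    have hswap : projTensorEntry i j j i = projTensorEntry i j i j := by
      ext ψ
      simp only [projTensorEntry]
      ring
    rw [hswap, hinv.integral_projTensorEntry_diag hsph]
    simp [eq_comm, add_comm]
  · simp [hinv.integral_projTensorEntry_eq_zero h₁ h₂, h₁, h₂]
end
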